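/- The inequality −3J ≤ U_β(c,n₁,n₂,n₃) holds for all β ∈ {α₁, α₂} and all c, n₁, n₂, n₃ ∈ {0,1,2} if and only if J ≥ 0, α₁ ≥ 0 and α₂ ≥ 0. (That is, the value U₆ = −3J is the minimal possible unit-ball energy exactly on the set A₆ = {(J,α₁,α₂) : J ≥ 0, α₁ ≥ 0, α₂ ≥ 0}.) -/

import Mathlib

/-- Unit-ball energy of the SOS model on the Cayley tree of order 2 with spin values
`{0,1,2}`, coupling `J`, where the center of the ball carries the external field
value `β`: for center spin `c` and neighbor spins `n₁, n₂, n₃`,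
`U_β(c,n₁,n₂,n₃) = -(J/2)·(|c−n₁| + |c−n₂| + |c−n₃|) + β·c`. -/
noncomputable def ballEnergy (J β : ℝ) (c n₁ n₂ n₃ : Fin 3) : ℝ :=
  -(J / 2) * (|((c : ℕ) : ℝ) - ((n₁ : ℕ) : ℝ)| + |((c : ℕ) : ℝ) - ((n₂ : ℕ) : ℝ)|
      + |((c : ℕ) : ℝ) - ((n₃ : ℕ) : ℝ)|)
    + β * ((c : ℕ) : ℝ)

theorem abs_fin_three_sub_le_two (a b : Fin 3) :
    |((a : ℕ) : ℝ) - ((b : ℕ) : ℝ)| ≤ 2 := by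
  fin_cases a <;> fin_cases b <;> norm_num [abs_le]

/-- `U₆ = −3J` is the minimal unit-ball energy exactly when `J ≥ 0`, `α₁ ≥ 0`
and `α₂ ≥ 0`. -/
theorem neg_three_J_min_iff (J α₁ α₂ : ℝ) :
    (∀ β ∈ ({α₁, α₂} : Set ℝ), ∀ c n₁ n₂ n₃ : Fin 3,
        -3*J ≤ ballEnergy J β c n₁ n₂ n₃) ↔
      (0 ≤ J ∧ 0 ≤ α₁ ∧ 0 ≤ α₂) := by
  constructor
  · intro h
    refine ⟨?_, ?_, ?_⟩
    · have h₀ := h α₁ (by simp) 0 0 0 0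
      norm_num [ballEnergy] at h₀
      linarith
    · have h₂ := h α₁ (by simp) 2 0 0 0
      norm_num [ballEnergy] at h₂
      linarith
    · have h₂ := h α₂ (by simp) 2 0 0 0
      norm_num [ballEnergy] at h₂
      linarith
  · rintro ⟨hJ, hα₁, hα₂⟩ β hβ c n₁ n₂ n₃
    have hβ₀ : 0 ≤ β := by
      rcases hβ with rfl | rfl <;> assumption
    have hc : 0 ≤ β * ((c : ℕ) : ℝ) := by positivity
    have h₁ := mul_le_mul_of_nonneg_left (abs_fin_three_sub_le_two c n₁) hJ
    have h₂ := mul_le_mul_of_nonneg_left (abs_fin_three_sub_le_two c n₂) hJ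
    have h₃ := mul_le_mul_of_nonneg_left (abs_fin_three_sub_le_two c n₃) hJ
    unfold ballEnergy
    linarith
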